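/- The socle of C_c(X)_F, i.e., the sum (supremum) of all minimal ideals of C_c(X)_F, equals the set of all f ∈ C_c(X)_F that vanish everywhere except on a finite subset of X, i.e., {f ∈ C_c(X)_F : COZ(f) is finite}. -/

import Mathlib

/-- The ring `C_c(X)_F` of real valued functions on `X` with countable range whose
set of points of discontinuity is finite, as a subring of `X → ℝ`. -/
def CcF (X : Type*) [TopologicalSpace X] : Subring (X → ℝ) where
  carrier := {f : X → ℝ | (Set.range f).Countable ∧ {x : X | ¬ ContinuousAt f x}.Finite}
  zero_mem' :=
    ⟨(Set.countable_singleton (0 : ℝ)).mono (Set.range_subset_iff.mpr fun _ => Set.mem_singleton _),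
      Set.finite_empty.subset fun x hx => (hx continuousAt_const).elim⟩
  one_mem' :=
    ⟨(Set.countable_singleton (1 : ℝ)).mono (Set.range_subset_iff.mpr fun _ => Set.mem_singleton _),
      Set.finite_empty.subset fun x hx => (hx continuousAt_const).elim⟩
  add_mem' := fun {f g} hf hg =>
    ⟨(Set.Countable.image2 hf.1 hg.1 (· + ·)).mono
        (by rintro - ⟨x, rfl⟩
            exact Set.mem_image2_of_mem (Set.mem_range_self x) (Set.mem_range_self x)),
      (hf.2.union hg.2).subset (by
        intro x hx
        by_contra h
        simp only [Set.mem_union, Set.mem_setOf_eq, not_or, not_not] at h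
        exact hx (h.1.add h.2))⟩
  neg_mem' := fun {f} hf =>
    ⟨(hf.1.image (fun t => -t)).mono
        (by rintro - ⟨x, rfl⟩; exact ⟨f x, Set.mem_range_self x, rfl⟩),
      hf.2.subset (by
        intro x hx
        by_contra h
        simp only [Set.mem_setOf_eq, not_not] at h
        exact hx h.neg)⟩
  mul_mem' := fun {f g} hf hg =>
    ⟨(Set.Countable.image2 hf.1 hg.1 (· * ·)).mono
        (by rintro - ⟨x, rfl⟩
            exact Set.mem_image2_of_mem (Set.mem_range_self x) (Set.mem_range_self x)),
      (hf.2.union hg.2).subset (by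
        intro x hx
        by_contra h
        simp only [Set.mem_union, Set.mem_setOf_eq, not_or, not_not] at h
        exact hx (h.1.mul h.2))⟩

/-- The zero set `Z(f)` of `f ∈ C_c(X)_F`. -/
def zSet {X : Type*} [TopologicalSpace X] (f : CcF X) : Set X := {x : X | (f : X → ℝ) x = 0}

/-- Two subsets `A`, `B` of `X` are `F_c`-completely separated if some `f ∈ C_c(X)_F`
is `0` on `A` and `1` on `B`. -/
def FcCompletelySeparated (X : Type*) [TopologicalSpace X] (A B : Set X) : Prop :=
  ∃ f : CcF X, (∀ a ∈ A, (f : X → ℝ) a = 0) ∧ (∀ b ∈ B, (f : X → ℝ) b = 1)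

namespace CcF

variable {X : Type*} [TopologicalSpace X]

/-- The ideal of functions with finite cozero set. -/
def finiteCozeroIdeal (X : Type*) [TopologicalSpace X] : Ideal (CcF X) where
  carrier := {f : CcF X | {x : X | (f : X → ℝ) x ≠ 0}.Finite}
  zero_mem' := by simp
  add_mem' := fun {f g} hf hg => by
    refine (Set.Finite.union hf hg).subset fun x hx => ?_
    by_contra h
    simp only [Set.mem_union, Set.mem_ofPred_eq, not_or, not_not] at h
    exact hx (by simp [h.1, h.2])
  smul_mem' := fun c f hf => by
    refine Set.Finite.subset hf fun x hx h => hx ?_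
    simp [h]

theorem exists_apply_ne_zero {g : CcF X} (hg : g ≠ 0) : ∃ x, (g : X → ℝ) x ≠ 0 := by
  by_contra! h
  exact hg (Subtype.ext (funext h))

variable [T1Space X]

open Classical in
/-- The function with value `c` at `x` and `0` elsewhere. -/
noncomputable def single (x : X) (c : ℝ) : CcF X :=
  ⟨Pi.single x c, by
    refine ⟨((Set.countable_singleton (0 : ℝ)).insert c).mono ?_,
      (Set.finite_singleton x).subset fun y hy => ?_⟩
    · rintro - ⟨y, rfl⟩
      by_cases h : y = x
      · subst h; simp
      · simp [h]
    · by_contra h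
      refine hy (ContinuousAt.congr (f := fun _ => (0 : ℝ)) continuousAt_const ?_)
      filter_upwards [isOpen_ne.mem_nhds h] with z hz
      exact (Pi.single_eq_of_ne (M := fun _ : X => ℝ) hz c).symm⟩

open Classical in
theorem single_apply (x y : X) (c : ℝ) :
    (single x c : X → ℝ) y = if y = x then c else 0 :=
  Pi.single_apply x c y

theorem single_mul (x : X) (c : ℝ) (g : CcF X) :
    single x c * g = single x (c * (g : X → ℝ) x) := by
  ext y
  by_cases h : y = x
  · subst h; simp [single_apply]
  · simp [single_apply, h]

theorem single_one_ne_zero (x : X) : single x 1 ≠ 0 := fun h => by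
  simpa [single_apply] using congrArg (fun g : CcF X => (g : X → ℝ) x) h

theorem single_one_mem {I : Ideal (CcF X)} {g : CcF X} (hg : g ∈ I) {x : X}
    (hx : (g : X → ℝ) x ≠ 0) : single x 1 ∈ I := by
  have h := I.mul_mem_left (single x ((g : X → ℝ) x)⁻¹) hg
  rwa [single_mul, inv_mul_cancel₀ hx] at h

theorem isAtom_span_single (x : X) : IsAtom (Ideal.span {single x (1 : ℝ)}) := by
  refine ⟨by simpa using single_one_ne_zero x, fun J hJ => ?_⟩
  by_contra hne
  obtain ⟨g, hgJ, hg⟩ := Submodule.exists_mem_ne_zero_of_ne_bot hne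
  obtain ⟨y, hy⟩ := exists_apply_ne_zero hg
  obtain ⟨a, rfl⟩ := Ideal.mem_span_singleton.1 (hJ.le hgJ)
  have hyx : y = x := by
    by_contra h
    exact hy (by simp [single_apply, h])
  subst hyx
  exact hJ.not_ge ((Ideal.span_singleton_le_iff_mem J).2 (single_one_mem hgJ hy))

theorem exists_eq_span_single {I : Ideal (CcF X)} (hI : IsAtom I) :
    ∃ x, I = Ideal.span {single x (1 : ℝ)} := by
  obtain ⟨g, hgI, hg⟩ := Submodule.exists_mem_ne_zero_of_ne_bot hI.1
  obtain ⟨x, hx⟩ := exists_apply_ne_zero hg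
  have hle := (Ideal.span_singleton_le_iff_mem I).2 (single_one_mem hgI hx)
  exact ⟨x, ((hI.le_iff_eq (isAtom_span_single x).1).1 hle).symm⟩

theorem single_mem_finiteCozeroIdeal (x : X) (c : ℝ) :
    single x c ∈ finiteCozeroIdeal X :=
  (Set.finite_singleton x).subset fun y hy => by
    by_contra h
    exact hy (by rw [single_apply, if_neg (mt Set.mem_singleton_iff.2 h)])

theorem eq_sum_single {f : CcF X} (hf : {x : X | (f : X → ℝ) x ≠ 0}.Finite) :
    f = ∑ x ∈ hf.toFinset, f * single x 1 := by
  classical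
  ext y
  simp only [AddSubmonoidClass.coe_finsetSum, Subring.coe_mul, Finset.sum_apply, Pi.mul_apply,
    single_apply, mul_ite, mul_one, mul_zero, Finset.sum_ite_eq, Set.Finite.mem_toFinset,
    Set.mem_ofPred_eq]
  split_ifs with h
  · rfl
  · exact not_not.1 h

end CcF

theorem stmt11 {X : Type*} [TopologicalSpace X] [T1Space X] (f : CcF X) :
    f ∈ sSup {I : Ideal (CcF X) | I ≠ ⊥ ∧ ∀ J : Ideal (CcF X), J < I → J = ⊥} ↔
      {x : X | (f : X → ℝ) x ≠ 0}.Finite := by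
  constructor
  · intro hf
    refine (sSup_le fun I hI => ?_ : _ ≤ CcF.finiteCozeroIdeal X) hf
    obtain ⟨x, rfl⟩ := CcF.exists_eq_span_single hI
    exact (Ideal.span_singleton_le_iff_mem _).2 (CcF.single_mem_finiteCozeroIdeal x 1)
  · intro hf
    rw [CcF.eq_sum_single hf]
    refine Ideal.sum_mem _ fun x _ => Ideal.mul_mem_left _ _ ?_
    have hle := le_sSup (show _ ∈ {I : Ideal (CcF X) | I ≠ ⊥ ∧ ∀ J, J < I → J = ⊥} from
      CcF.isAtom_span_single x)
    exact hle (Ideal.mem_span_singleton_self _)
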